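/- Let X be a T0 space and, for each x ∈ X, let Y_x be an irreducible T0 space. Then the sum space Z = Σ_X Y_x (with the topology whose open sets have open slices and open nonempty-slice projection) is T0, the map y ↦ (y,x) is a topological embedding of Y_x into Z for every x, and if X is irreducible then Z is irreducible. -/

import Mathlib

/-- In the sum space, an open subset of a summand is the trace of an open set: keep every other
summand whole. -/
theorem exists_isOpen_sigma_slice_eq {X : Type*} [TopologicalSpace X] {Y : X → Type*}
    [∀ x, TopologicalSpace (Y x)] [∀ x, Nonempty (Y x)]
    (t : TopologicalSpace (Σ x, Y x))
    (ht : ∀ U : Set (Σ x, Y x), t.IsOpen U ↔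
      ((∀ x, IsOpen {y : Y x | (⟨x, y⟩ : Σ x, Y x) ∈ U}) ∧
        IsOpen {x : X | {y : Y x | (⟨x, y⟩ : Σ x, Y x) ∈ U}.Nonempty}))
    (x : X) {V : Set (Y x)} (hV : IsOpen V) :
    ∃ U : Set (Σ x, Y x), t.IsOpen U ∧ (fun y : Y x => (⟨x, y⟩ : Σ x, Y x)) ⁻¹' U = V := by
  rcases V.eq_empty_or_nonempty with rfl | hne
  · exact ⟨∅, @isOpen_empty _ t, rfl⟩
  let U : Set (Σ x, Y x) := {z | ∀ y : Y x, z = ⟨x, y⟩ → y ∈ V}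
  have h_self : {y : Y x | (⟨x, y⟩ : Σ x, Y x) ∈ U} = V := by
    ext y
    refine ⟨fun h => h y rfl, fun h y' e => ?_⟩
    cases e
    exact h
  have h_other : ∀ x' ≠ x, {y : Y x' | (⟨x', y⟩ : Σ x, Y x) ∈ U} = Set.univ := by
    refine fun x' hx => Set.eq_univ_of_forall fun y y' e => ?_
    exact absurd (congrArg Sigma.fst e) hx
  refine ⟨U, (ht U).2 ⟨fun x' => ?_, ?_⟩, h_self⟩
  · by_cases hx : x' = x
    · subst hx
      rwa [h_self]
    · rw [h_other x' hx]
      exact isOpen_univ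
  · convert isOpen_univ
    refine Set.eq_univ_of_forall fun x' => ?_
    by_cases hx : x' = x
    · subst hx
      rwa [Set.mem_ofPred_eq, h_self]
    · rw [Set.mem_ofPred_eq, h_other x' hx]
      exact Set.univ_nonempty

/-- In the sum space, the preimage of an open set of the base is open. -/
theorem isOpen_sigma_preimage_fst_of_slices {X : Type*} [TopologicalSpace X] {Y : X → Type*}
    [∀ x, TopologicalSpace (Y x)] [∀ x, Nonempty (Y x)]
    (t : TopologicalSpace (Σ x, Y x))
    (ht : ∀ U : Set (Σ x, Y x), t.IsOpen U ↔
      ((∀ x, IsOpen {y : Y x | (⟨x, y⟩ : Σ x, Y x) ∈ U}) ∧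
        IsOpen {x : X | {y : Y x | (⟨x, y⟩ : Σ x, Y x) ∈ U}.Nonempty}))
    {W : Set X} (hW : IsOpen W) : t.IsOpen (Sigma.fst ⁻¹' W) := by
  refine (ht _).2 ⟨fun x => isOpen_const (p := x ∈ W), ?_⟩
  convert hW using 1
  ext x
  exact ⟨fun ⟨_, h⟩ => h, fun h => ⟨Classical.arbitrary _, h⟩⟩

/-- Let `X` be T0 and each `Y x` an irreducible T0 space. Then the sum space
`Z = Σ_X Y_x` (with the topology whose opens have open slices and open
nonempty-slice projection) is T0, each map `y ↦ (y, x)` is a topological embedding,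
and if `X` is irreducible then so is `Z`. -/
theorem stmt18 {X : Type*} [TopologicalSpace X] [T0Space X] (Y : X → Type*)
    [∀ x, TopologicalSpace (Y x)] [∀ x, T0Space (Y x)]
    (hirr : ∀ x, Nonempty (Y x) ∧ ∀ U V : Set (Y x), IsOpen U → IsOpen V →
      U.Nonempty → V.Nonempty → (U ∩ V).Nonempty)
    (t : TopologicalSpace (Σ x, Y x))
    (ht : ∀ U : Set (Σ x, Y x), t.IsOpen U ↔
      ((∀ x, IsOpen {y : Y x | (⟨x, y⟩ : Σ x, Y x) ∈ U}) ∧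
        IsOpen {x : X | {y : Y x | (⟨x, y⟩ : Σ x, Y x) ∈ U}.Nonempty})) :
    (∀ p q : Σ x, Y x, (∀ U : Set (Σ x, Y x), t.IsOpen U → (p ∈ U ↔ q ∈ U)) → p = q) ∧
    (∀ x : X, @Topology.IsEmbedding (Y x) (Σ x, Y x) _ t (fun y => ⟨x, y⟩)) ∧
    ((Nonempty X ∧ ∀ U V : Set X, IsOpen U → IsOpen V → U.Nonempty → V.Nonempty →
        (U ∩ V).Nonempty) →
      (Nonempty (Σ x, Y x) ∧ ∀ U V : Set (Σ x, Y x), t.IsOpen U → t.IsOpen V →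
        U.Nonempty → V.Nonempty → (U ∩ V).Nonempty)) := by
  have hne : ∀ x, Nonempty (Y x) := fun x => (hirr x).1
  refine ⟨?_, fun x => ?_, ?_⟩
  · rintro ⟨x, y⟩ ⟨x', y'⟩ h
    obtain rfl : x = x' := Inseparable.eq <| inseparable_iff_forall_isOpen.2 fun W hW =>
      h _ (isOpen_sigma_preimage_fst_of_slices t ht hW)
    obtain rfl : y = y' := Inseparable.eq <| inseparable_iff_forall_isOpen.2 fun V hV => by
      obtain ⟨U, hU, rfl⟩ := exists_isOpen_sigma_slice_eq t ht x hV
      exact h U hU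
    rfl
  · refine @Topology.IsEmbedding.mk _ _ _ t _ (@Topology.IsInducing.mk _ _ _ t _ ?_)
      sigma_mk_injective
    refine TopologicalSpace.ext_iff.2 fun V => ⟨fun hV => ?_, ?_⟩
    · exact exists_isOpen_sigma_slice_eq t ht x hV
    · rintro ⟨U, hU, rfl⟩
      exact ((ht U).1 hU).1 x
  · rintro ⟨⟨x₀⟩, hX⟩
    refine ⟨⟨⟨x₀, Classical.arbitrary _⟩⟩, ?_⟩
    rintro U V hU hV ⟨⟨a, u⟩, hu⟩ ⟨⟨b, v⟩, hv⟩
    obtain ⟨x, hxU, hxV⟩ := hX _ _ ((ht U).1 hU).2 ((ht V).1 hV).2 ⟨a, u, hu⟩ ⟨b, v, hv⟩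
    obtain ⟨y, hyU, hyV⟩ := (hirr x).2 _ _ (((ht U).1 hU).1 x) (((ht V).1 hV).1 x) hxU hxV
    exact ⟨⟨x, y⟩, hyU, hyV⟩
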